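/- arXiv:0911.1475 — 2 statements merged into one kernel-verified Lean document; each statement's English description precedes it below -/
import Mathlib

section
/- Let p be a prime, q = p², and let N be a positive divisor of q−1 that does not divide p−1. Let n : F_q → ℕ and suppose that the polynomial A = ∏_{γ ∈ F_q} (x−γ)^{N·p^{n(γ)} − 1} ∈ F_q[x] is perfect. Then n(γ) = n(δ) for all γ, δ ∈ F_q; consequently, writing n for this common value, A = (x^q − x)^{N·p^n − 1}. -/
open Polynomial

/-- The sum of all monic divisors of a polynomial. -/
noncomputable def polySigma {F : Type*} [Field F] (A : F[X]) : F[X] :=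
  ∑ᶠ d ∈ {d : F[X] | d.Monic ∧ d ∣ A}, d

/-- A polynomial is perfect if it equals the sum of its monic divisors. -/
def IsPerfectPoly {F : Type*} [Field F] (A : F[X]) : Prop := polySigma A = A

section LinearFactors

variable {F : Type*} [Field F] [Fintype F]

theorem count_roots_prod_X_sub_C_pow [DecidableEq F] (k : F → ℕ) (δ : F) :
    (∏ γ : F, (X - C γ) ^ k γ : F[X]).roots.count δ = k δ := by
  have hne : (∏ γ : F, (X - C γ) ^ k γ : F[X]) ≠ 0 :=
    Finset.prod_ne_zero_iff.mpr fun γ _ => pow_ne_zero _ (X_sub_C_ne_zero γ)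
  rw [roots_prod _ _ hne, Multiset.count_bind]
  simp [Multiset.count_singleton]

theorem prod_X_sub_C_pow_injective :
    Function.Injective fun k : F → ℕ => (∏ γ : F, (X - C γ) ^ k γ : F[X]) := by
  classical
  intro k l h
  funext δ
  have := congrArg (fun P : F[X] => P.roots.count δ) h
  simpa only [count_roots_prod_X_sub_C_pow] using this

theorem monic_dvd_prod_X_sub_C_pow_iff (e : F → ℕ) (d : F[X]) :
    (d.Monic ∧ d ∣ ∏ γ : F, (X - C γ) ^ e γ) ↔
      ∃ k : F → ℕ, (∀ γ, k γ ≤ e γ) ∧ ∏ γ : F, (X - C γ) ^ k γ = d := by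
  classical
  have hne : (∏ γ : F, (X - C γ) ^ e γ : F[X]) ≠ 0 :=
    Finset.prod_ne_zero_iff.mpr fun γ _ => pow_ne_zero _ (X_sub_C_ne_zero γ)
  constructor
  · rintro ⟨hm, hd⟩
    have hs : d.Splits :=
      (Splits.prod fun γ _ => (Splits.X_sub_C γ).pow (e γ)).of_dvd hne hd
    refine ⟨fun γ => d.roots.count γ, fun γ => ?_, ?_⟩
    · rw [← count_roots_prod_X_sub_C_pow e γ]
      exact Multiset.count_le_of_le _ (roots.le_of_dvd hne hd)
    · conv_rhs => rw [hs.eq_prod_roots_of_monic hm, Finset.prod_multiset_map_count]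
      symm
      refine Finset.prod_subset (Finset.subset_univ _) fun γ _ hγ => ?_
      rw [Multiset.count_eq_zero_of_notMem (by simpa using hγ), pow_zero]
  · rintro ⟨k, hk, rfl⟩
    exact ⟨monic_prod_of_monic _ _ fun γ _ => (monic_X_sub_C γ).pow _,
      Finset.prod_dvd_prod_of_dvd _ _ fun γ _ => pow_dvd_pow _ (hk γ)⟩

theorem polySigma_prod_X_sub_C_pow (e : F → ℕ) :
    polySigma (∏ γ : F, (X - C γ) ^ e γ : F[X]) =
      ∏ γ : F, ∑ i ∈ Finset.range (e γ + 1), (X - C γ) ^ i := by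
  classical
  have hset : {d : F[X] | d.Monic ∧ d ∣ ∏ γ : F, (X - C γ) ^ e γ} =
      (fun k : F → ℕ => (∏ γ : F, (X - C γ) ^ k γ : F[X])) ''
        (Fintype.piFinset fun γ => Finset.range (e γ + 1)) := by
    ext d
    rw [Set.mem_ofPred_eq, monic_dvd_prod_X_sub_C_pow_iff]
    simp
  rw [Finset.prod_univ_sum, polySigma, hset, finsum_mem_image prod_X_sub_C_pow_injective.injOn,
    finsum_mem_coe_finset]

theorem sum_eq_of_isPerfectPoly {p : ℕ} [Fact p.Prime] [CharP F p] {N : ℕ} (hN : 0 < N)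
    {ζ : F} (hζ : IsPrimitiveRoot ζ N) (n : F → ℕ)
    (hperf : IsPerfectPoly (∏ γ : F, (X - C γ) ^ (N * p ^ n γ - 1))) (δ : F) :
    ∑ ξ ∈ nthRootsFinset N (1 : F), p ^ n (δ - ξ) = N * p ^ n δ := by
  have hpos (γ : F) : 0 < N * p ^ n γ := Nat.mul_pos hN (pow_pos (Fact.out : p.Prime).pos _)
  have hroots (γ : F) : (X - C γ : F[X]) ^ N - 1 =
      ∏ ξ ∈ nthRootsFinset N (1 : F), (X - C (γ + ξ)) := by
    have := congrArg (fun P : F[X] => P.comp (X - C γ)) (X_pow_sub_one_eq_prod hN hζ)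
    simpa [prod_comp, sub_sub] using this
  have hgeom (γ : F) : (∑ i ∈ Finset.range (N * p ^ n γ - 1 + 1), (X - C γ : F[X]) ^ i) *
      (X - C (γ + 1)) = ∏ ξ ∈ nthRootsFinset N (1 : F), (X - C (γ + ξ)) ^ p ^ n γ := by
    rw [Nat.sub_add_cancel (hpos γ), Finset.prod_pow, ← hroots, sub_pow_char_pow, one_pow,
      ← pow_mul, ← geom_sum_mul, C_add, C_1, sub_sub]
  rw [IsPerfectPoly, polySigma_prod_X_sub_C_pow] at hperf
  have hlinear : (∏ γ : F, (X - C (γ + 1)) : F[X]) = ∏ γ : F, (X - C γ) :=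
    Equiv.prod_comp (Equiv.addRight (1 : F)) fun γ => (X - C γ : F[X])
  have hprod : (∏ γ : F, (X - C γ) ^ (∑ ξ ∈ nthRootsFinset N (1 : F), p ^ n (γ - ξ)) : F[X]) =
      ∏ γ : F, (X - C γ) ^ (N * p ^ n γ) := by
    calc
      _ = ∏ ξ ∈ nthRootsFinset N (1 : F), ∏ γ : F, (X - C γ : F[X]) ^ p ^ n (γ - ξ) := by
        simp_rw [← Finset.prod_pow_eq_pow_sum]
        rw [Finset.prod_comm]
      _ = ∏ ξ ∈ nthRootsFinset N (1 : F), ∏ γ : F, (X - C (γ + ξ) : F[X]) ^ p ^ n γ := by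
        refine Finset.prod_congr rfl fun ξ _ => ?_
        rw [← Equiv.prod_comp (Equiv.addRight ξ)]
        simp
      _ = _ := by
        rw [Finset.prod_comm, ← Finset.prod_congr rfl fun γ _ => hgeom γ,
          Finset.prod_mul_distrib, hperf, hlinear, ← Finset.prod_mul_distrib]
        refine Finset.prod_congr rfl fun γ _ => ?_
        rw [← pow_succ, Nat.sub_add_cancel (hpos γ)]
  exact congrFun (prod_X_sub_C_pow_injective hprod) δ

theorem prod_X_sub_C_univ : (∏ γ : F, (X - C γ) : F[X]) = X ^ Fintype.card F - X := by
  have hm : (X ^ Fintype.card F - X : F[X]).Monic :=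
    monic_X_pow_sub (by rw [degree_X]; exact_mod_cast Fintype.one_lt_card)
  have := prod_multiset_X_sub_C_of_monic_of_roots_card_eq hm (by
    rw [FiniteField.roots_X_pow_card_sub_X,
      FiniteField.X_pow_card_sub_X_natDegree_eq F Fintype.one_lt_card]
    rfl)
  rwa [FiniteField.roots_X_pow_card_sub_X] at this

end LinearFactors

/-- A function on a finite group averaging over translates by `S` is constant as soon as `S`
generates the group. -/
theorem eq_of_sum_translates_eq {G : Type*} [AddCommGroup G] [Finite G] {S : Finset G}
    (hS : AddSubgroup.closure (S : Set G) = ⊤) {f : G → ℕ}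
    (hf : ∀ x, ∑ s ∈ S, f (x - s) = S.card * f x) (x y : G) : f x = f y := by
  obtain ⟨m, hm⟩ := Finite.exists_max f
  have hmax : ∀ t : G, ∀ x, f x = f m → f (x - t) = f m := by
    intro t
    have ht : t ∈ AddSubgroup.closure (S : Set G) := hS ▸ AddSubgroup.mem_top t
    induction ht using AddSubgroup.closure_induction with
    | mem s hs =>
      intro x hx
      have hsum : ∑ s ∈ S, f (x - s) = ∑ _s ∈ S, f m := by
        rw [hf, hx, Finset.sum_const, smul_eq_mul]
      exact (Finset.sum_eq_sum_iff_of_le fun s _ => hm (x - s)).mp hsum s hs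
    | zero => simp
    | add a b _ _ ha hb =>
      intro x hx
      rw [← sub_sub]
      exact hb _ (ha x hx)
    | neg a _ ha =>
      have hmul (k : ℕ) : ∀ x, f x = f m → f (x - k • a) = f m := by
        induction k with
        | zero => simp
        | succ k ih =>
          intro x hx
          rw [succ_nsmul, ← sub_sub]
          exact ha _ (ih x hx)
      obtain ⟨k, hk⟩ : ∃ k : ℕ, k • a = -a := by
        refine ⟨addOrderOf a - 1, eq_neg_of_add_eq_zero_left ?_⟩
        rw [← succ_nsmul, Nat.sub_add_cancel (addOrderOf_pos a), addOrderOf_nsmul_eq_zero]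
      exact hk ▸ hmul k
  have hconst (z : G) : f z = f m := by simpa using hmax (m - z) m rfl
  rw [hconst x, hconst y]

theorem closure_nthRootsFinset_eq_top {p : ℕ} [Fact p.Prime] {F : Type*} [Field F] [Fintype F]
    [CharP F p] (hcard : Fintype.card F = p ^ 2) {N : ℕ} (hN : 0 < N) (hNp : ¬ N ∣ p - 1)
    {ζ : F} (hζ : IsPrimitiveRoot ζ N) :
    AddSubgroup.closure (nthRootsFinset N (1 : F) : Set F) = ⊤ := by
  have hp : p.Prime := Fact.out
  set H := AddSubgroup.closure (nthRootsFinset N (1 : F) : Set F) with hH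
  have hmem {ξ : F} (h : ξ ^ N = 1) : ξ ∈ H :=
    AddSubgroup.subset_closure (by simpa [mem_nthRootsFinset hN] using h)
  have hle : AddSubgroup.zmultiples (1 : F) ≤ H :=
    AddSubgroup.zmultiples_le_of_mem (hmem (one_pow N))
  have hZ : Nat.card (AddSubgroup.zmultiples (1 : F)) = p := by
    rw [Nat.card_zmultiples]
    exact CharP.eq F (CharP.addOrderOf_one F) inferInstance
  have hFcard : Nat.card F = p ^ 2 := by rw [Nat.card_eq_fintype_card, hcard]
  obtain ⟨k, hk, hHk⟩ := (Nat.dvd_prime_pow hp).mp (hFcard ▸ H.card_addSubgroup_dvd_card)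
  have hpH : p ∣ Nat.card H := hZ ▸ AddSubgroup.card_dvd_of_le hle
  interval_cases k
  · rw [hHk, pow_zero] at hpH
    exact absurd hpH hp.not_dvd_one
  · exfalso
    have heq : AddSubgroup.zmultiples (1 : F) = H :=
      AddSubgroup.eq_of_le_of_card_ge hle (by rw [hHk, hZ, pow_one])
    have hζH : ζ ∈ AddSubgroup.zmultiples (1 : F) := heq ▸ hmem hζ.pow_eq_one
    obtain ⟨a, ha⟩ := AddSubgroup.mem_zmultiples_iff.mp hζH
    have hfrob : ζ ^ p = ζ := by
      rw [← ha, zsmul_one]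
      exact map_intCast (frobenius F p) a
    refine hNp (hζ.dvd_of_pow_eq_one _ (mul_right_cancel₀ (hζ.ne_zero hN.ne') ?_))
    rw [← pow_succ, Nat.sub_add_cancel hp.one_le, hfrob, one_mul]
  · exact AddSubgroup.eq_top_of_card_eq _ (by rw [hHk, hFcard])

theorem exists_isPrimitiveRoot_of_dvd_card_sub_one {F : Type*} [Field F] [Fintype F] {N : ℕ}
    (hN : N ∣ Fintype.card F - 1) : ∃ ζ : F, IsPrimitiveRoot ζ N := by
  classical
  obtain ⟨g, hg⟩ := IsCyclic.exists_ofOrder_eq_natCard (α := Fˣ)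
  obtain ⟨m, hm⟩ := hN
  rw [Nat.card_eq_fintype_card, Fintype.card_units] at hg
  have hg' : IsPrimitiveRoot (g : F) (Fintype.card F - 1) :=
    hg ▸ (IsPrimitiveRoot.coe_units_iff.mpr (IsPrimitiveRoot.orderOf g))
  exact ⟨_, hg'.pow (Nat.sub_pos_of_lt Fintype.one_lt_card) (hm.trans (mul_comm N m))⟩

theorem stmt0 (p : ℕ) (hp : p.Prime) (F : Type*) [Field F] [Fintype F]
    (hcard : Fintype.card F = p ^ 2)
    (N : ℕ) (hN1 : 0 < N) (hNq : N ∣ p ^ 2 - 1) (hNp : ¬ N ∣ p - 1)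
    (n : F → ℕ)
    (hperf : IsPerfectPoly (∏ γ : F, (X - C γ) ^ (N * p ^ n γ - 1))) :
    (∀ γ δ : F, n γ = n δ) ∧
      ∀ γ : F, (∏ δ : F, (X - C δ) ^ (N * p ^ n δ - 1) : F[X])
        = (X ^ (p ^ 2) - X) ^ (N * p ^ n γ - 1) := by
  have : Fact p.Prime := ⟨hp⟩
  have : CharP F p := charP_of_card_eq_prime_pow hcard
  obtain ⟨ζ, hζ⟩ := exists_isPrimitiveRoot_of_dvd_card_sub_one (F := F) (hcard ▸ hNq)
  have hconst (γ δ : F) : n γ = n δ := by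
    refine Nat.pow_right_injective hp.two_le
      (eq_of_sum_translates_eq (f := fun x => p ^ n x)
        (closure_nthRootsFinset_eq_top hcard hN1 hNp hζ) (fun x => ?_) γ δ)
    rw [hζ.card_nthRootsFinset]
    exact sum_eq_of_isPerfectPoly hN1 hζ n hperf x
  refine ⟨hconst, fun γ => ?_⟩
  rw [← hcard, ← prod_X_sub_C_univ, ← Finset.prod_pow]
  exact Finset.prod_congr rfl fun δ _ => by rw [hconst δ γ]
end

section
/- Let p be a prime, q = p², and let N ≥ 2 be a divisor of p−1. Define a_0, …, a_{p−1} ∈ ℚ by a_1 = −N, a_i = 1 if (1−i)^N = 1 in F_p (for i ≠ 1), and a_i = 0 otherwise, where i ∈ {0, …, p−1} is identified with an element of F_p. Then the p×p circulant matrix C over ℚ with entries C(m,n) = a_{n−m} (indices taken in ℤ/pℤ) has rank p−1. -/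
theorem ZMod.card_filter_pow_eq_one {p : ℕ} [Fact p.Prime] {N : ℕ} (hN : N ∣ p - 1) :
    (Finset.univ.filter fun u : ZMod p => u ^ N = 1).card = N := by
  have hp1 : 0 < p - 1 := Nat.sub_pos_of_lt (Fact.out : p.Prime).one_lt
  have hN0 : 0 < N := Nat.pos_of_dvd_of_pos hN hp1
  obtain ⟨g, hg⟩ := IsCyclic.exists_ofOrder_eq_natCard (α := (ZMod p)ˣ)
  rw [Nat.card_eq_fintype_card, ZMod.card_units] at hg
  obtain ⟨k, hk⟩ := hN
  have h1 : IsPrimitiveRoot (g : ZMod p) (p - 1) := by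
    rw [IsPrimitiveRoot.coe_units_iff, ← hg]
    exact IsPrimitiveRoot.orderOf g
  have h2 := h1.pow hp1 (hk.trans (mul_comm _ _))
  refine Eq.trans ?_ h2.card_nthRootsFinset
  congr 1
  ext u
  simp [Polynomial.mem_nthRootsFinset hN0]

theorem ZMod.eq_of_apply_sub_one_eq {p : ℕ} [NeZero p] {P : ZMod p → Prop} {k : ZMod p}
    (hk : P k) (h : ∀ j, P j → P (j - 1)) (j : ZMod p) : P j := by
  have key : ∀ n : ℕ, P (k - n) := by
    intro n
    induction n with
    | zero => simpa using hk
    | succ n ih => simpa [sub_sub] using h _ ih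
  simpa using key (k - j).val

/-- A function on `ZMod p` that equals its average over the translates by a finite set containing
`1` is constant. -/
theorem ZMod.apply_eq_of_mul_eq_sum {p : ℕ} [NeZero p] {S : Finset (ZMod p)} (hS : 1 ∈ S)
    {x : ZMod p → ℚ} (hx : ∀ k, (S.card : ℚ) * x k = ∑ u ∈ S, x (k - u)) (i j : ZMod p) :
    x i = x j := by
  obtain ⟨k, hk⟩ := Finite.exists_max x
  have key : ∀ j, x j = x k := by
    refine ZMod.eq_of_apply_sub_one_eq (P := fun j => x j = x k) rfl fun j hj => ?_
    have h0 : ∑ u ∈ S, (x k - x (j - u)) = 0 := by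
      rw [Finset.sum_sub_distrib, ← hx j, hj]
      simp
    have h1 := (Finset.sum_eq_zero_iff_of_nonneg fun u _ => sub_nonneg.2 (hk (j - u))).1 h0 1 hS
    linarith
  rw [key i, key j]

theorem stmt8 (p : ℕ) (hp : p.Prime) [NeZero p]
    (N : ℕ) (hN2 : 2 ≤ N) (hNp : N ∣ p - 1)
    (a : ZMod p → ℚ)
    (ha : ∀ i : ZMod p,
      a i = if i = 1 then -(N : ℚ) else if ((1 : ZMod p) - i) ^ N = 1 then 1 else 0) :
    (Matrix.of fun m n : ZMod p => a (n - m)).rank = p - 1 := by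
  have : Fact p.Prime := ⟨hp⟩
  set S := Finset.univ.filter fun u : ZMod p => u ^ N = 1 with hS
  have hcard : S.card = N := ZMod.card_filter_pow_eq_one hNp
  have ha' : ∀ u : ZMod p, a (1 - u)
      = (if u ^ N = 1 then 1 else 0) - if u = 0 then (N : ℚ) else 0 := by
    intro u
    rw [ha]
    by_cases hu : u = 0
    · simp [hu, show N ≠ 0 by omega]
    · simp [hu]
  have hmul : ∀ (x : ZMod p → ℚ) (m : ZMod p),
      (Matrix.of fun m n : ZMod p => a (n - m)).mulVec x m
        = ∑ u ∈ S, x (m + 1 - u) - S.card * x (m + 1) := by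
    intro x m
    rw [hcard, Matrix.mulVec, dotProduct, ← Equiv.sum_comp (Equiv.subLeft (m + 1))]
    have hsub : ∀ u : ZMod p, m + 1 - u - m = 1 - u := fun u => by ring
    simp [hsub, ha', sub_mul, Finset.sum_sub_distrib, hS, Finset.sum_filter]
  have hker : LinearMap.ker (Matrix.of fun m n : ZMod p => a (n - m)).mulVecLin
      = Submodule.span ℚ {(1 : ZMod p → ℚ)} := by
    ext x
    rw [LinearMap.mem_ker, Matrix.mulVecLin_apply, Submodule.mem_span_singleton]
    constructor
    · intro h
      refine ⟨x 0, funext fun j => ?_⟩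
      have hx : ∀ k, (S.card : ℚ) * x k = ∑ u ∈ S, x (k - u) := by
        intro k
        have := hmul x (k - 1)
        rw [h, sub_add_cancel, Pi.zero_apply] at this
        linarith
      simpa using ZMod.apply_eq_of_mul_eq_sum (by simp [hS]) hx 0 j
    · rintro ⟨c, rfl⟩
      ext m
      rw [hmul]
      simp
  have h := LinearMap.finrank_range_add_finrank_ker
    (Matrix.of fun m n : ZMod p => a (n - m)).mulVecLin
  rw [hker, finrank_span_singleton one_ne_zero, Module.finrank_fintype_fun_eq_card, ZMod.card] at h
  rw [Matrix.rank]
  omega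
end
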